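/- If G and F are two holomorphic IFS that satisfy the strong separation condition and share the same attractor, then for every λ ∈ σ(G) there exists l ∈ ℕ such that λ^l ∈ σ(F), and the same holds after switching G and F; moreover, all such exponents l can be taken uniformly bounded by a finite number depending only on F and G. -/

import Mathlib

open Set Metric

noncomputable section

/-- A finite holomorphic IFS: a bounded domain `Ω ⊂ ℂ` together with finitely many
univalent maps `g i : Ω → Ω` with `closure (g i '' Ω) ⊆ Ω`. -/
structure HolIFS where
  /-- the number of maps -/
  m : ℕ
  hm : 1 ≤ m
  /-- the domain -/
  Ω : Set ℂ
  hopen : IsOpen Ω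
  hconn : IsConnected Ω
  hbdd : Bornology.IsBounded Ω
  /-- the maps of the IFS -/
  g : Fin m → ℂ → ℂ
  hdiff : ∀ i, DifferentiableOn ℂ (g i) Ω
  hinj : ∀ i, Set.InjOn (g i) Ω
  hcl : ∀ i, closure (g i '' Ω) ⊆ Ω

/-- `A` is the attractor of the IFS `S`: the (unique) nonempty compact subset of `Ω`
with `A = ⋃ i, g i '' A`. -/
def HolIFS.IsAttractor (S : HolIFS) (A : Set ℂ) : Prop :=
  A.Nonempty ∧ IsCompact A ∧ A ⊆ S.Ω ∧ A = ⋃ i, S.g i '' A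

/-- The strong separation condition for the IFS `S` with attractor `A`. -/
def HolIFS.SSC (S : HolIFS) (A : Set ℂ) : Prop :=
  ∀ i j : Fin S.m, i ≠ j → Disjoint (S.g i '' A) (S.g j '' A)

/-- For a finite word `w = [i₁, …, i_k]`, the composition `g_w = g i₁ ∘ ⋯ ∘ g i_k`. -/
def HolIFS.word (S : HolIFS) (w : List (Fin S.m)) : ℂ → ℂ :=
  w.foldr (fun i f => S.g i ∘ f) id

/-- The multiplier (dynamical) spectrum of the IFS `S`: the set of derivatives
`g_w'(β_w)` at the fixed points `β_w` of the compositions `g_w`, over all finite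
words `w`. -/
def HolIFS.spectrum (S : HolIFS) : Set ℂ :=
  {lam | ∃ (w : List (Fin S.m)) (β : ℂ), w ≠ [] ∧ β ∈ S.Ω ∧ S.word w β = β ∧
    deriv (S.word w) β = lam}


open Filter Topology

theorem deriv_ne_zero_of_injOn {f : ℂ → ℂ} {U : Set ℂ} (hU : IsOpen U)
    (hf : DifferentiableOn ℂ f U) (hinj : InjOn f U) {z₀ : ℂ} (hz : z₀ ∈ U) :
    deriv f z₀ ≠ 0 := by
  have hUn : U ∈ 𝓝 z₀ := hU.mem_nhds hz
  have hfa : AnalyticAt ℂ f z₀ := hf.analyticAt hUn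
  have hFa : AnalyticAt ℂ (fun z => f z - f z₀) z₀ := hfa.sub analyticAt_const
  have hne : ¬ ∀ᶠ z in 𝓝 z₀, f z - f z₀ = 0 := by
    intro h
    have h2 : ∀ᶠ z in 𝓝[≠] z₀, f z - f z₀ = 0 ∧ z ∈ U :=
      (h.and hUn).filter_mono nhdsWithin_le_nhds
    obtain ⟨z, ⟨h3, h4⟩, h5⟩ := (h2.and self_mem_nhdsWithin).exists
    exact h5 (hinj h4 hz (sub_eq_zero.1 h3))
  obtain ⟨n, g, hga, hg0, hg⟩ := hFa.exists_eventuallyEq_pow_smul_nonzero_iff.2 hne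
  intro hd
  have hn0 : n ≠ 0 := by
    rintro rfl
    have := hg.self_of_nhds
    simp at this
    exact hg0 this.symm
  -- root
  set k : ℂ → ℂ := fun z => Complex.exp (Complex.log (g z / g z₀) / n) with hk
  have hka : AnalyticAt ℂ k z₀ := by
    apply AnalyticAt.cexp
    apply AnalyticAt.div _ analyticAt_const (by exact_mod_cast hn0)
    apply AnalyticAt.clog
    · exact hga.div analyticAt_const hg0
    · simp [div_self hg0]
  have hkn : ∀ᶠ z in 𝓝 z₀, k z ^ n = g z / g z₀ := by
    filter_upwards [hga.continuousAt.eventually_ne hg0] with z hz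
    rw [hk]
    simp only
    rw [← Complex.exp_nat_mul, mul_div_cancel₀ _ (by exact_mod_cast hn0), Complex.exp_log]
    exact div_ne_zero hz hg0
  have hk0 : k z₀ = 1 := by simp [hk, div_self hg0]
  set φ : ℂ → ℂ := fun z => (z - z₀) * k z with hφ
  have hφd : HasStrictDerivAt φ 1 z₀ := by
    have h0 : HasStrictDerivAt (fun z : ℂ => z - z₀) 1 z₀ := (hasStrictDerivAt_id z₀).sub_const z₀
    have h1 : HasStrictDerivAt φ (1 * k z₀ + (z₀ - z₀) * deriv k z₀) z₀ :=
      HasStrictDerivAt.mul h0 hka.hasStrictDerivAt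
    simpa [hk0] using h1
  have hφm := hφd.map_nhds_eq one_ne_zero
  have hφ0 : φ z₀ = 0 := by simp [hφ]
  have hV : {z | z ∈ U ∧ f z - f z₀ = g z₀ * φ z ^ n} ∈ 𝓝 z₀ := by
    filter_upwards [hUn, hg, hkn] with z h1 h2 h3
    refine ⟨h1, ?_⟩
    rw [h2, hφ]
    simp only [mul_pow, h3, smul_eq_mul]
    field_simp
  have himg : φ '' {z | z ∈ U ∧ f z - f z₀ = g z₀ * φ z ^ n} ∈ 𝓝 (0:ℂ) := by
    rw [← hφ0, ← hφm]; exact image_mem_map hV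
  by_cases hn1 : n = 1
  · subst hn1
    have h1 : HasDerivAt (fun z => f z - f z₀) (g z₀) z₀ := by
      have h2 : HasDerivAt (fun z => g z₀ * φ z ^ 1) (g z₀) z₀ := by
        simpa using hφd.hasDerivAt.const_mul (g z₀)
      apply h2.congr_of_eventuallyEq
      filter_upwards [hV] with z hz using hz.2
    have h3 : HasDerivAt (fun z => f z - f z₀) (deriv f z₀) z₀ :=
      hfa.differentiableAt.hasDerivAt.sub_const _
    exact hg0 (by rw [h1.unique h3, hd])
  · have hprim := Complex.isPrimitiveRoot_exp n hn0
    set ζ := Complex.exp (2 * Real.pi * Complex.I / n)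
    have hζ : ζ ≠ 1 := hprim.ne_one (by omega)
    have h1 : ∀ᶠ t in 𝓝 (0:ℂ), t ∈ φ '' {z | z ∈ U ∧ f z - f z₀ = g z₀ * φ z ^ n} := himg
    have h2 : ∀ᶠ t in 𝓝 (0:ℂ), ζ * t ∈ φ '' {z | z ∈ U ∧ f z - f z₀ = g z₀ * φ z ^ n} := by
      have : Tendsto (fun t : ℂ => ζ * t) (𝓝 0) (𝓝 0) := by
        have h9 : Continuous fun t : ℂ => ζ * t := by fun_prop
        have := h9.tendsto 0
        simp only [mul_zero] at this
        exact this
      exact this himg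
    have h3 : ∀ᶠ t in 𝓝[≠] (0:ℂ), _ := (h1.and h2).filter_mono nhdsWithin_le_nhds
    obtain ⟨t, ⟨⟨z1, hz1, e1⟩, ⟨z2, hz2, e2⟩⟩, ht⟩ := (h3.and self_mem_nhdsWithin).exists
    have : f z1 - f z₀ = f z2 - f z₀ := by
      rw [hz1.2, hz2.2, e1, e2, mul_pow, hprim.pow_eq_one, one_mul]
    have h5 : z1 = z2 := hinj hz1.1 hz2.1 (by simpa using this)
    rw [← h5, e1] at e2
    apply hζ
    have : (ζ - 1) * t = 0 := by rw [sub_mul, ← e2]; ring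
    rcases mul_eq_zero.1 this with h | h
    · exact sub_eq_zero.1 h
    · exact absurd h ht

namespace HolIFS
variable (S : HolIFS)

theorem word_nil : S.word [] = id := rfl
theorem word_cons (i) (v) : S.word (i :: v) = S.g i ∘ S.word v := rfl
theorem word_append (u v) : S.word (u ++ v) = S.word u ∘ S.word v := by
  induction u with
  | nil => rfl
  | cons i u ih => rw [List.cons_append, word_cons, ih, word_cons]; rfl

theorem g_mapsTo (i) : MapsTo (S.g i) S.Ω S.Ω := fun z hz =>
  S.hcl i (subset_closure (mem_image_of_mem _ hz))

theorem word_mapsTo (v) : MapsTo (S.word v) S.Ω S.Ω := by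
  induction v with
  | nil => exact fun z hz => hz
  | cons i v ih => exact (S.g_mapsTo i).comp ih

theorem word_diff (v) : DifferentiableOn ℂ (S.word v) S.Ω := by
  induction v with
  | nil => exact differentiableOn_id
  | cons i v ih => exact (S.hdiff i).comp ih (S.word_mapsTo v)

theorem word_inj (v) : InjOn (S.word v) S.Ω := by
  induction v with
  | nil => exact injOn_id _
  | cons i v ih => exact (S.hinj i).comp ih (S.word_mapsTo v)

theorem word_diffAt (v) {z} (hz : z ∈ S.Ω) : DifferentiableAt ℂ (S.word v) z :=
  (S.word_diff v).differentiableAt (S.hopen.mem_nhds hz)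

theorem g_diffAt (i) {z} (hz : z ∈ S.Ω) : DifferentiableAt ℂ (S.g i) z :=
  (S.hdiff i).differentiableAt (S.hopen.mem_nhds hz)

theorem word_deriv_ne (v) {z} (hz : z ∈ S.Ω) : deriv (S.word v) z ≠ 0 :=
  deriv_ne_zero_of_injOn S.hopen (S.word_diff v) (S.word_inj v) hz

theorem deriv_word_append (u v) {z} (hz : z ∈ S.Ω) :
    deriv (S.word (u ++ v)) z = deriv (S.word u) (S.word v z) * deriv (S.word v) z := by
  rw [word_append, deriv_comp _ (S.word_diffAt u (S.word_mapsTo v hz)) (S.word_diffAt v hz)]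

theorem deriv_word_cons (i v) {z} (hz : z ∈ S.Ω) :
    deriv (S.word (i :: v)) z = deriv (S.g i) (S.word v z) * deriv (S.word v) z := by
  rw [word_cons, deriv_comp _ (S.g_diffAt i (S.word_mapsTo v hz)) (S.word_diffAt v hz)]

/-- Earle–Hamilton type decay. -/
theorem decay_aux : ∃ q : ℝ, 0 < q ∧ q < 1 ∧ ∀ (v : List (Fin S.m)) (φ : ℂ → ℂ),
    DifferentiableOn ℂ φ S.Ω → (∀ z ∈ S.Ω, ‖φ z‖ ≤ 1) → ∀ z ρ, 0 < ρ → ball z ρ ⊆ S.Ω →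
    ‖deriv φ (S.word v z)‖ * ‖deriv (S.word v) z‖ ≤ q ^ v.length * (2 / ρ) := by
  obtain ⟨R, hR0, hR⟩ := S.hbdd.exists_pos_norm_le
  have hδ : ∀ i, ∃ δ > 0, ∀ x ∈ S.Ω, ball (S.g i x) δ ⊆ S.Ω := by
    intro i
    have hc : IsCompact (closure (S.g i '' S.Ω)) :=
      (S.hbdd.subset ((subset_closure).trans (S.hcl i))).isCompact_closure
    obtain ⟨δ, h0, h1⟩ := hc.exists_thickening_subset_open S.hopen (S.hcl i)
    refine ⟨δ, h0, fun x hx => (ball_subset_thickening (subset_closure ?_) δ).trans h1⟩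
    exact mem_image_of_mem _ hx
  choose δ hδ0 hδ1 using hδ
  have : Nonempty (Fin S.m) := ⟨⟨0, S.hm⟩⟩
  obtain ⟨i0, hi0⟩ := Finite.exists_min δ
  set η := δ i0 / (4 * R) with hη
  have hη0 : 0 < η := by have := hδ0 i0; positivity
  refine ⟨(1 + η)⁻¹, by positivity, inv_lt_one_of_one_lt₀ (by linarith), ?_⟩
  intro v
  induction v with
  | nil =>
    intro φ hφ hb z ρ hρ hball
    have : ‖deriv φ z‖ ≤ 2 / ρ := by
      apply Complex.norm_deriv_le_div_of_mapsTo_ball (hφ.mono hball) _ hρ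
      intro x hx
      rw [mem_closedBall, dist_eq_norm]
      have h1 := hb x (hball hx)
      have h2 := hb z (hball (mem_ball_self hρ))
      calc _ ≤ ‖φ x‖ + ‖φ z‖ := norm_sub_le _ _
        _ ≤ 2 := by linarith
    simpa [word_nil] using this
  | cons i v ih =>
    intro φ hφ hb z ρ hρ hball
    have hz : z ∈ S.Ω := hball (mem_ball_self hρ)
    set z1 := S.word v z with hz1
    have hz1Ω : z1 ∈ S.Ω := S.word_mapsTo v hz
    set e : ℂ → ℂ := fun ζ => S.g i ζ + (η:ℂ) * (S.g i ζ - S.g i z1) with he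
    have hemaps : MapsTo e S.Ω S.Ω := by
      intro x hx
      apply hδ1 i x hx
      rw [mem_ball, dist_eq_norm, he]
      simp only [add_sub_cancel_left, norm_mul, Complex.norm_real, Real.norm_eq_abs, abs_of_pos hη0]
      have h1 := hR _ (S.g_mapsTo i hx)
      have h2 := hR _ (S.g_mapsTo i hz1Ω)
      calc _ ≤ η * (R + R) := by
            gcongr
            exact (norm_sub_le _ _).trans (by linarith)
        _ = δ i0 / 2 := by rw [hη]; field_simp; ring
        _ < δ i := by have := hi0 i; have := hδ0 i0; linarith
    have hed : DifferentiableOn ℂ e S.Ω := by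
      have := S.hdiff i
      fun_prop
    have hed1 : HasDerivAt e ((1 + η) * deriv (S.g i) z1) z1 := by
      have h := (S.g_diffAt i hz1Ω).hasDerivAt
      have h2 : HasDerivAt e (deriv (S.g i) z1 + (η:ℂ) * deriv (S.g i) z1) z1 :=
        HasDerivAt.add h ((HasDerivAt.sub_const (S.g i z1) h).const_mul (η:ℂ))
      have h3 : (1 + (η:ℂ)) * deriv (S.g i) z1 = deriv (S.g i) z1 + (η:ℂ) * deriv (S.g i) z1 := by
        ring
      rw [h3]; exact h2
    have he1 : e z1 = S.g i z1 := by simp [he]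
    have h := ih (φ ∘ e) (hφ.comp hed hemaps) (fun x hx => hb _ (hemaps hx)) z ρ hρ hball
    have hφat : DifferentiableAt ℂ φ (e z1) :=
      hφ.differentiableAt (S.hopen.mem_nhds (hemaps hz1Ω))
    rw [← hz1, deriv_comp _ hφat hed1.differentiableAt, hed1.deriv, he1] at h
    rw [S.deriv_word_cons i v hz, word_cons, Function.comp_apply, ← hz1, List.length_cons, pow_succ]
    have hn : ‖(1 + η : ℂ)‖ = 1 + η := by
      rw [← Complex.ofReal_one, ← Complex.ofReal_add, Complex.norm_real, Real.norm_eq_abs,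
        abs_of_pos (by linarith)]
    rw [norm_mul, norm_mul, hn] at h
    rw [norm_mul]
    have h1η : 0 < 1 + η := by linarith
    calc _ = (1 + η)⁻¹ * (‖deriv φ (S.g i z1)‖ * ((1 + η) * ‖deriv (S.g i) z1‖) *
          ‖deriv (S.word v) z‖) := by field_simp
      _ ≤ (1 + η)⁻¹ * ((1 + η)⁻¹ ^ v.length * (2 / ρ)) := by gcongr
      _ = _ := by ring

theorem decay : ∃ q C : ℝ, 0 < q ∧ q < 1 ∧ 0 < C ∧ ∀ (v : List (Fin S.m)) z ρ, 0 < ρ →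
    ball z ρ ⊆ S.Ω → ‖deriv (S.word v) z‖ ≤ C / ρ * q ^ v.length := by
  obtain ⟨q, hq0, hq1, h⟩ := S.decay_aux
  obtain ⟨R, hR0, hR⟩ := S.hbdd.exists_pos_norm_le
  refine ⟨q, 2 * R, hq0, hq1, by positivity, fun v z ρ hρ hb => ?_⟩
  have := h v (fun z => (R:ℂ)⁻¹ * z) (by fun_prop) (fun z hz => by
    rw [norm_mul, norm_inv, Complex.norm_real, Real.norm_eq_abs, abs_of_pos hR0,
      inv_mul_le_iff₀ hR0, mul_one]
    exact hR z hz) z ρ hρ hb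
  have hd : deriv (fun z => (R:ℂ)⁻¹ * z) (S.word v z) = (R:ℂ)⁻¹ := by
    simp [deriv_const_mul_field]
  rw [hd, norm_inv, Complex.norm_real, Real.norm_eq_abs, abs_of_pos hR0,
      inv_mul_le_iff₀ hR0] at this
  calc _ ≤ _ := this
    _ = _ := by ring

end HolIFS


namespace HolIFS
variable (S : HolIFS)

theorem contr : ∃ q : ℝ, 0 < q ∧ q < 1 ∧
    (∀ K : Set ℂ, IsCompact K → K ⊆ S.Ω → ∃ C ρ : ℝ, 0 < C ∧ 0 < ρ ∧ (∀ y ∈ K, ball y ρ ⊆ S.Ω) ∧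
      ∀ v, ∀ y ∈ K, ∀ x ∈ ball y ρ, ∀ x' ∈ ball y ρ,
        ‖S.word v x - S.word v x'‖ ≤ C * q ^ v.length * ‖x - x'‖) ∧
    (∀ K : Set ℂ, IsCompact K → K ⊆ S.Ω → ∃ C : ℝ, 0 < C ∧ ∀ v, ∀ x ∈ K, ∀ x' ∈ K,
        ‖S.word v x - S.word v x'‖ ≤ C * q ^ v.length) := by
  obtain ⟨q, C₀, hq0, hq1, hC0, h⟩ := S.decay
  have key : ∀ K : Set ℂ, IsCompact K → K ⊆ S.Ω → ∃ C ρ : ℝ, 0 < C ∧ 0 < ρ ∧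
      (∀ y ∈ K, ball y ρ ⊆ S.Ω) ∧
      ∀ v, ∀ y ∈ K, ∀ x ∈ ball y ρ, ∀ x' ∈ ball y ρ,
        ‖S.word v x - S.word v x'‖ ≤ C * q ^ v.length * ‖x - x'‖ := by
    intro K hK hKΩ
    obtain ⟨δ, h0, h1⟩ := hK.exists_thickening_subset_open S.hopen hKΩ
    have hb : ∀ y ∈ K, ball y δ ⊆ S.Ω := fun y hy => (ball_subset_thickening hy δ).trans h1
    have hb' : ∀ y ∈ K, ball y (δ/2) ⊆ S.Ω := fun y hy =>
      (ball_subset_ball (by linarith)).trans (hb y hy)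
    refine ⟨C₀ / (δ/2), δ/2, by positivity, by positivity, hb', ?_⟩
    intro v y hy x hx x' hx'
    apply (convex_ball y (δ/2)).norm_image_sub_le_of_norm_deriv_le (𝕜 := ℂ) _ _ hx' hx
    · exact fun z hz => S.word_diffAt v (hb' y hy hz)
    · intro z hz
      apply h v z (δ/2) (by positivity)
      refine (ball_subset_ball' ?_).trans (hb y hy)
      rw [mem_ball] at hz; linarith
  refine ⟨q, hq0, hq1, key, ?_⟩
  have pt : ∀ z ∈ S.Ω, ∀ w ∈ S.Ω, ∃ C : ℝ, ∀ v, ‖S.word v z - S.word v w‖ ≤ C * q ^ v.length := by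
    intro z hz w hw
    refine S.hconn.isPreconnected.induction₂
      (fun z w => ∃ C : ℝ, ∀ v, ‖S.word v z - S.word v w‖ ≤ C * q ^ v.length) ?_ ?_ ?_ hz hw
    · intro x hx
      obtain ⟨C, ρ, hC, hρ, _, hh⟩ := key {x} isCompact_singleton (singleton_subset_iff.2 hx)
      filter_upwards [mem_nhdsWithin_of_mem_nhds (ball_mem_nhds x hρ)] with y hy
      exact ⟨C * ‖x - y‖, fun v => (hh v x rfl x (mem_ball_self hρ) y hy).trans_eq (by ring)⟩
    · rintro x y z _ _ _ ⟨C, hC⟩ ⟨C', hC'⟩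
      refine ⟨C + C', fun v => ?_⟩
      calc _ ≤ ‖S.word v x - S.word v y‖ + ‖S.word v y - S.word v z‖ := norm_sub_le_norm_sub_add_norm_sub _ _ _
        _ ≤ _ := by linarith [hC v, hC' v]
    · rintro x y _ _ ⟨C, hC⟩
      exact ⟨C, fun v => by rw [norm_sub_rev]; exact hC v⟩
  intro K hK hKΩ
  rcases K.eq_empty_or_nonempty with rfl | ⟨z0, hz0⟩
  · exact ⟨1, one_pos, fun v x hx => hx.elim⟩
  obtain ⟨C, ρ, hC, hρ, hbΩ, hh⟩ := key K hK hKΩ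
  obtain ⟨C', hC'⟩ : ∃ C : ℝ, ∀ x ∈ K, ∀ v, ‖S.word v x - S.word v z0‖ ≤ C * q ^ v.length := by
    obtain ⟨t, htK, htf, hcov⟩ := hK.finite_cover_balls hρ
    have : ∀ y ∈ t, ∃ C : ℝ, ∀ v, ‖S.word v y - S.word v z0‖ ≤ C * q ^ v.length :=
      fun y hy => pt y (hKΩ (htK hy)) z0 (hKΩ hz0)
    choose! D hD using this
    obtain ⟨M, hM⟩ := (htf.image D).bddAbove
    refine ⟨C * ρ + M, fun x hx v => ?_⟩
    obtain ⟨y, hy, hxy⟩ := mem_iUnion₂.1 (hcov hx)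
    have h1 := hh v y (htK hy) x hxy y (mem_ball_self hρ)
    have h2 := hD y hy v
    have h3 : D y ≤ M := hM (mem_image_of_mem _ hy)
    have h4 : ‖x - y‖ ≤ ρ := by rw [← dist_eq_norm]; exact (mem_ball.1 hxy).le
    have hqv : 0 < q ^ v.length := by positivity
    calc _ ≤ ‖S.word v x - S.word v y‖ + ‖S.word v y - S.word v z0‖ := norm_sub_le_norm_sub_add_norm_sub _ _ _
      _ ≤ C * q ^ v.length * ‖x - y‖ + D y * q ^ v.length := add_le_add h1 h2
      _ ≤ C * q ^ v.length * ρ + M * q ^ v.length := by gcongr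
      _ = _ := by ring
  refine ⟨max (2 * C') 1, by positivity, fun v x hx x' hx' => ?_⟩
  have h1 := hC' x hx v
  have h2 := hC' x' hx' v
  rw [norm_sub_rev] at h2
  have hqv : 0 < q ^ v.length := by positivity
  calc _ ≤ ‖S.word v x - S.word v z0‖ + ‖S.word v z0 - S.word v x'‖ := norm_sub_le_norm_sub_add_norm_sub _ _ _
    _ ≤ (2 * C') * q ^ v.length := by linarith
    _ ≤ _ := by gcongr; exact le_max_left _ _

variable {S} {A : Set ℂ}

theorem IsAttractor.g_mem (hA : S.IsAttractor A) (i) {x} (hx : x ∈ A) : S.g i x ∈ A := by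
  rw [hA.2.2.2]; exact mem_iUnion.2 ⟨i, mem_image_of_mem _ hx⟩

theorem IsAttractor.word_mem (hA : S.IsAttractor A) (v) {x} (hx : x ∈ A) : S.word v x ∈ A := by
  induction v with
  | nil => exact hx
  | cons i v ih => exact hA.g_mem i ih

theorem IsAttractor.exists_pre (hA : S.IsAttractor A) {x} (hx : x ∈ A) :
    ∃ i, ∃ y ∈ A, S.g i y = x := by
  have h := hA.2.2.2 ▸ hx
  obtain ⟨i, y, hy, e⟩ := mem_iUnion.1 h
  exact ⟨i, y, hy, e⟩

/-- one step bounds -/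
theorem IsAttractor.onestep (hA : S.IsAttractor A) : ∃ L ρ c : ℝ, 0 < L ∧ 0 < ρ ∧ 0 < c ∧ c ≤ 1 ∧
    (∀ i, ∀ b ∈ A, c ≤ ‖deriv (S.g i) b‖) ∧
    ∀ i, ∀ b ∈ A, ∀ a ∈ ball b ρ,
      ‖deriv (S.g i) a - deriv (S.g i) b‖ ≤ L * ‖a - b‖ * ‖deriv (S.g i) b‖ := by
  obtain ⟨hne, hAc, hAΩ, -⟩ := hA
  obtain ⟨ρ, h0, h1⟩ := hAc.exists_cthickening_subset_open S.hopen hAΩ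
  have hd : ∀ i, DifferentiableOn ℂ (deriv (S.g i)) S.Ω := fun i => (S.hdiff i).deriv S.hopen
  have hdd : ∀ i, DifferentiableOn ℂ (deriv (deriv (S.g i))) S.Ω := fun i => (hd i).deriv S.hopen
  have : Nonempty (Fin S.m) := ⟨⟨0, S.hm⟩⟩
  have hc : ∀ i, ∃ c > 0, ∀ b ∈ A, c ≤ ‖deriv (S.g i) b‖ := by
    intro i
    obtain ⟨b, hb, hmin⟩ := hAc.exists_isMinOn hne (((hd i).continuousOn.mono hAΩ).norm)
    exact ⟨_, norm_pos_iff.2 (deriv_ne_zero_of_injOn S.hopen (S.hdiff i) (S.hinj i) (hAΩ hb)),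
      fun x hx => hmin hx⟩
  choose c hc0 hc using hc
  obtain ⟨i0, hi0⟩ := Finite.exists_min c
  have hM : ∀ i, ∃ M, ∀ x ∈ cthickening ρ A, ‖deriv (deriv (S.g i)) x‖ ≤ M := fun i =>
    (hAc.cthickening).exists_bound_of_continuousOn ((hdd i).continuousOn.mono h1)
  choose M hM using hM
  obtain ⟨i1, hi1⟩ := Finite.exists_max M
  refine ⟨(|M i1| + 1) / c i0, ρ, min (c i0) 1, by have := hc0 i0; positivity, h0,
    lt_min (hc0 i0) one_pos, min_le_right _ _,
    fun i b hb => (min_le_left _ _).trans ((hi0 i).trans (hc i b hb)), ?_⟩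
  intro i b hb a ha
  have hsub : ball b ρ ⊆ cthickening ρ A :=
    (ball_subset_thickening hb ρ).trans (thickening_subset_cthickening _ _)
  have h2 : ‖deriv (S.g i) a - deriv (S.g i) b‖ ≤ (|M i1| + 1) * ‖a - b‖ := by
    apply (convex_ball b ρ).norm_image_sub_le_of_norm_deriv_le (𝕜 := ℂ) _ _ (mem_ball_self h0) ha
    · exact fun z hz => (hd i).differentiableAt (S.hopen.mem_nhds (h1 (hsub hz)))
    · intro z hz
      have := hM i z (hsub hz)
      have := hi1 i
      have := le_abs_self (M i1)
      linarith
  have h3 : 1 ≤ ‖deriv (S.g i) b‖ / c i0 := by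
    rw [le_div_iff₀ (hc0 i0), one_mul]; exact (hi0 i).trans (hc i b hb)
  calc _ ≤ (|M i1| + 1) * ‖a - b‖ := h2
    _ ≤ (|M i1| + 1) * ‖a - b‖ * (‖deriv (S.g i) b‖ / c i0) := le_mul_of_one_le_right (by positivity) h3
    _ = _ := by ring

/-- bounded distortion -/
theorem IsAttractor.distortion (hA : S.IsAttractor A) {η : ℝ} (hη : 0 < η) :
    ∃ r₀ > 0, ∀ r, 0 < r → r ≤ r₀ → (∀ y ∈ A, ball y r ⊆ S.Ω) ∧
      ∀ v, ∀ y ∈ A, ∀ x ∈ ball y r, ∀ x' ∈ ball y r,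
      ‖S.word v x - S.word v x' - deriv (S.word v) y * (x - x')‖ ≤
        η * ‖deriv (S.word v) y‖ * ‖x - x'‖ := by
  obtain ⟨q, hq0, hq1, hK, -⟩ := S.contr
  obtain ⟨C, ρ, hC, hρ, hbΩ, hlip⟩ := hK A hA.2.1 hA.2.2.1
  obtain ⟨L, ρ', c, hL, hρ', -, -, -, hstep⟩ := hA.onestep
  have hlog : 0 < Real.log (1 + η) := Real.log_pos (by linarith)
  have h1q : 0 < 1 - q := by linarith
  refine ⟨min ρ (min (ρ' / (2 * C)) (Real.log (1 + η) * (1 - q) / (L * C))),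
    by positivity, ?_⟩
  intro r hr hr'
  have hr1 : r ≤ ρ := hr'.trans (min_le_left _ _)
  have hr2 : r ≤ ρ' / (2 * C) := hr'.trans ((min_le_right _ _).trans (min_le_left _ _))
  have hr3 : r ≤ Real.log (1 + η) * (1 - q) / (L * C) :=
    hr'.trans ((min_le_right _ _).trans (min_le_right _ _))
  rw [le_div_iff₀ (by positivity)] at hr2 hr3
  have hbr : ∀ y ∈ A, ball y r ⊆ S.Ω := fun y hy => (ball_subset_ball hr1).trans (hbΩ y hy)
  refine ⟨hbr, ?_⟩
  have main : ∀ v, ∀ y ∈ A, ∀ x ∈ ball y r, ‖deriv (S.word v) x - deriv (S.word v) y‖ ≤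
      (Real.exp (L * C * r * ((1 - q ^ v.length) / (1 - q))) - 1) * ‖deriv (S.word v) y‖ := by
    intro v y hy x hx
    have hxΩ := hbr y hy hx
    have hyΩ := hA.2.2.1 hy
    induction v with
    | nil => simp [word_nil]
    | cons i v ih =>
      rw [S.deriv_word_cons i v hxΩ, S.deriv_word_cons i v hyΩ]
      have hl := hlip v y hy x (ball_subset_ball hr1 hx) y (mem_ball_self hρ)
      have hxy : ‖x - y‖ < r := by rw [← dist_eq_norm]; exact hx
      have hqv : 0 < q ^ v.length := by positivity
      have hqv1 : q ^ v.length ≤ 1 := pow_le_one₀ hq0.le hq1.le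
      have hl' : ‖S.word v x - S.word v y‖ ≤ C * r * q ^ v.length := by
        calc _ ≤ _ := hl
          _ ≤ C * q ^ v.length * r := by gcongr
          _ = _ := by ring
      have hball : S.word v x ∈ ball (S.word v y) ρ' := by
        rw [mem_ball, dist_eq_norm]
        calc _ ≤ C * r * q ^ v.length := hl'
          _ ≤ C * r * 1 := by gcongr
          _ < ρ' := by nlinarith [mul_pos hC hr]
      have hs := hstep i _ (hA.word_mem v hy) _ hball
      set a := deriv (S.g i) (S.word v x)
      set a' := deriv (S.g i) (S.word v y)
      set b := deriv (S.word v) x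
      set b' := deriv (S.word v) y
      set E := Real.exp (L * C * r * ((1 - q ^ v.length) / (1 - q)))
      set t := L * C * r * q ^ v.length with ht
      have hs' : ‖a - a'‖ ≤ t * ‖a'‖ := by
        calc _ ≤ _ := hs
          _ ≤ L * (C * r * q ^ v.length) * ‖a'‖ := by gcongr
          _ = _ := by rw [ht]; ring
      have hb : ‖b‖ ≤ E * ‖b'‖ := by
        calc ‖b‖ = ‖(b - b') + b'‖ := by rw [sub_add_cancel]
          _ ≤ ‖b - b'‖ + ‖b'‖ := norm_add_le _ _
          _ ≤ (E - 1) * ‖b'‖ + ‖b'‖ := by gcongr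
          _ = _ := by ring
      have hE : Real.exp (L * C * r * ((1 - q ^ (i :: v).length) / (1 - q))) = Real.exp t * E := by
        rw [← Real.exp_add, ht]
        congr 1
        rw [List.length_cons, pow_succ]
        field_simp
        ring
      have ht0 : 0 < t := by positivity
      rw [hE]
      have hexp : 1 + t ≤ Real.exp t := by linarith [Real.add_one_le_exp t]
      calc ‖a * b - a' * b'‖ = ‖(a - a') * b + a' * (b - b')‖ := by congr 1; ring
        _ ≤ ‖a - a'‖ * ‖b‖ + ‖a'‖ * ‖b - b'‖ := by
            refine (norm_add_le _ _).trans ?_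
            rw [norm_mul, norm_mul]
        _ ≤ (t * ‖a'‖) * (E * ‖b'‖) + ‖a'‖ * ((E - 1) * ‖b'‖) := by gcongr
        _ = ((1 + t) * E - 1) * ‖a' * b'‖ := by rw [norm_mul]; ring
        _ ≤ (Real.exp t * E - 1) * ‖a' * b'‖ := by gcongr
  have main2 : ∀ v, ∀ y ∈ A, ∀ x ∈ ball y r, ‖deriv (S.word v) x - deriv (S.word v) y‖ ≤
      η * ‖deriv (S.word v) y‖ := by
    intro v y hy x hx
    refine (main v y hy x hx).trans ?_
    gcongr
    have hqv : 0 < q ^ v.length := by positivity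
    have : L * C * r * ((1 - q ^ v.length) / (1 - q)) ≤ Real.log (1 + η) := by
      rw [← mul_div_assoc, div_le_iff₀ h1q]
      calc _ ≤ L * C * r * 1 := by gcongr; linarith
        _ ≤ _ := by linarith
    have := Real.exp_le_exp.2 this
    rw [Real.exp_log (by linarith)] at this
    linarith
  intro v y hy x hx x' hx'
  set D := deriv (S.word v) y with hD
  have := (convex_ball y r).norm_image_sub_le_of_norm_hasDerivWithin_le (𝕜 := ℂ)
    (f := fun z => S.word v z - D * z) (f' := fun z => deriv (S.word v) z - D)
    (C := η * ‖D‖) (fun z hz => by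
      have h := (S.word_diffAt v (hbr y hy hz)).hasDerivAt
      have h2 : HasDerivAt (fun z : ℂ => D * z) D z := by
        simpa using (hasDerivAt_id z).const_mul D
      exact (HasDerivAt.sub h h2).hasDerivWithinAt) (fun z hz => main2 v y hy z hz) hx' hx
  have e : S.word v x - S.word v x' - D * (x - x') =
    (S.word v x - D * x) - (S.word v x' - D * x') := by ring
  rw [e]; exact this

/-- pull back of the attractor -/
theorem IsAttractor.gap (hA : S.IsAttractor A) (hS : S.SSC A) :
    ∃ δ > 0, ∀ i j, ∀ x ∈ S.g i '' A, ∀ y ∈ S.g j '' A, ‖x - y‖ < δ → i = j := by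
  have hc : ∀ i, IsCompact (S.g i '' A) := fun i =>
    hA.2.1.image_of_continuousOn ((S.hdiff i).continuousOn.mono hA.2.2.1)
  have : ∀ p : Fin S.m × Fin S.m, ∃ δ > 0, ∀ x ∈ S.g p.1 '' A, ∀ y ∈ S.g p.2 '' A,
      ‖x - y‖ < δ → p.1 = p.2 := by
    rintro ⟨i, j⟩
    by_cases hij : i = j
    · exact ⟨1, one_pos, fun _ _ _ _ _ => hij⟩
    obtain ⟨δ, h0, h⟩ := (hS i j hij).exists_thickenings (hc i) (hc j).isClosed
    refine ⟨δ, h0, fun x hx y hy hxy => ?_⟩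
    refine (Set.disjoint_left.1 h (self_subset_thickening h0 _ hx) ?_).elim
    exact mem_thickening_iff.2 ⟨y, hy, by rwa [dist_eq_norm]⟩
  choose δ hδ0 hδ using this
  have : Nonempty (Fin S.m) := ⟨⟨0, S.hm⟩⟩
  obtain ⟨p, hp⟩ := Finite.exists_min δ
  exact ⟨δ p, hδ0 p, fun i j x hx y hy h => hδ (i, j) x hx y hy (h.trans_le (hp _))⟩

theorem IsAttractor.pullback (hA : S.IsAttractor A) (hS : S.SSC A) :
    ∃ r₀ > 0, ∀ v, ∀ y ∈ A, ∀ x ∈ ball y r₀, S.word v x ∈ A → x ∈ A := by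
  obtain ⟨q, hq0, hq1, hK, -⟩ := S.contr
  obtain ⟨C, ρ, hC, hρ, hbΩ, hlip⟩ := hK A hA.2.1 hA.2.2.1
  obtain ⟨δ, hδ, hgap⟩ := hA.gap hS
  refine ⟨min ρ (δ / (2 * C)), by positivity, ?_⟩
  intro v y hy x hx
  have hxρ : x ∈ ball y ρ := ball_subset_ball (min_le_left _ _) hx
  have hxδ : ‖x - y‖ < δ / (2 * C) := by
    rw [← dist_eq_norm]; exact (mem_ball.1 hx).trans_le (min_le_right _ _)
  rw [lt_div_iff₀ (by positivity)] at hxδ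
  have hxΩ := hbΩ y hy hxρ
  induction v with
  | nil => exact id
  | cons i v ih =>
    intro h
    apply ih
    obtain ⟨j, z, hz, e⟩ := hA.exists_pre h
    have hl := hlip (i :: v) y hy x hxρ y (mem_ball_self hρ)
    have hqv1 : q ^ (i :: v).length ≤ 1 := pow_le_one₀ hq0.le hq1.le
    have hij : i = j := by
      refine hgap i j (S.word (i :: v) y) ⟨_, hA.word_mem v hy, rfl⟩ _ ⟨z, hz, e⟩ ?_
      rw [norm_sub_rev]
      calc _ ≤ _ := hl
        _ ≤ C * 1 * ‖x - y‖ := by gcongr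
        _ < δ := by nlinarith [norm_nonneg (x - y)]
    subst hij
    have := S.hinj i (hA.2.2.1 hz) (S.word_mapsTo v hxΩ) e
    rwa [← this]

end HolIFS


theorem surj_of_approx {f : ℂ → ℂ} {y D : ℂ} {r η s : ℝ} (hD : D ≠ 0) (hη0 : 0 ≤ η)
    (hη : η ≤ 1 / 2) (hs0 : 0 ≤ s) (hs : s < r)
    (h : ∀ x ∈ ball y r, ∀ x' ∈ ball y r, ‖f x - f x' - D * (x - x')‖ ≤ η * ‖D‖ * ‖x - x'‖)
    {p : ℂ} (hp : ‖p - f y‖ ≤ ‖D‖ * s / 2) : ∃ x, ‖x - y‖ ≤ s ∧ f x = p := by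
  have hDn : 0 < ‖D‖ := norm_pos_iff.2 hD
  have hap : ApproximatesLinearOn f (D • ContinuousLinearMap.id ℂ ℂ) (ball y r)
      (⟨η * ‖D‖, by positivity⟩) := by
    intro x hx x' hx'
    have h2 := h x hx x' hx'
    simp only [ContinuousLinearMap.smul_apply, ContinuousLinearMap.id_apply, smul_eq_mul]
    exact h2
  let R : (D • ContinuousLinearMap.id ℂ ℂ).NonlinearRightInverse :=
    { toFun := fun z => D⁻¹ * z
      nnnorm := ‖D‖₊⁻¹
      bound' := fun z => by simp
      right_inv' := fun z => by simp [hD] }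
  have := hap.surjOn_closedBall_of_nonlinearRightInverse R hs0 (closedBall_subset_ball hs)
  have hpm : p ∈ closedBall (f y) (((R.nnnorm : ℝ)⁻¹ - (⟨η * ‖D‖, by positivity⟩ : NNReal)) * s) := by
    rw [mem_closedBall, dist_eq_norm]
    refine hp.trans ?_
    have : ((R.nnnorm : ℝ)⁻¹) = ‖D‖ := by simp [R]
    rw [this]
    change ‖D‖ * s / 2 ≤ (‖D‖ - η * ‖D‖) * s
    have : 0 ≤ ‖D‖ * s := by positivity
    nlinarith
  obtain ⟨x, hx, e⟩ := this hpm
  exact ⟨x, by rw [← dist_eq_norm]; exact hx, e⟩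

namespace HolIFS
variable {S : HolIFS} {A : Set ℂ}

theorem IsAttractor.decayA (hA : S.IsAttractor A) : ∃ C q : ℝ, 0 < C ∧ 0 < q ∧ q < 1 ∧
    ∀ v, ∀ y ∈ A, ‖deriv (S.word v) y‖ ≤ C * q ^ v.length := by
  obtain ⟨q, C, hq0, hq1, hC, h⟩ := S.decay
  obtain ⟨δ, h0, h1⟩ := hA.2.1.exists_thickening_subset_open S.hopen hA.2.2.1
  exact ⟨C / δ, q, by positivity, hq0, hq1, fun v y hy =>
    h v y δ h0 ((ball_subset_thickening hy δ).trans h1)⟩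

theorem IsAttractor.coding (hA : S.IsAttractor A) {x : ℂ} (hx : x ∈ A) :
    ∃ (p : ℕ → List (Fin S.m)) (y : ℕ → ℂ), p 0 = [] ∧ y 0 = x ∧ (∀ n, y n ∈ A) ∧
      (∀ n, (p n).length = n) ∧ (∀ n, S.word (p n) (y n) = x) ∧
      ∀ n k, ∃ u, u.length = k ∧ p (n + k) = p n ++ u ∧ S.word u (y (n + k)) = y n := by
  have h : ∀ x ∈ A, ∃ i, ∃ y ∈ A, S.g i y = x := fun x hx => hA.exists_pre hx
  have : Nonempty (Fin S.m) := ⟨⟨0, S.hm⟩⟩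
  choose! i Y hY he using h
  set y : ℕ → ℂ := fun n => Y^[n] x
  have hyA : ∀ n, y n ∈ A := by
    intro n
    induction n with
    | zero => exact hx
    | succ n ih => simp only [y, Function.iterate_succ_apply']; exact hY _ ih
  have hyg : ∀ n, S.g (i (y n)) (y (n + 1)) = y n := by
    intro n
    have : y (n + 1) = Y (y n) := by simp only [y, Function.iterate_succ_apply']
    rw [this]; exact he _ (hyA n)
  set p : ℕ → List (Fin S.m) := fun n => (List.range n).map (fun k => i (y k))
  have hps : ∀ n, p (n + 1) = p n ++ [i (y n)] := by
    intro n; simp [p, List.range_succ]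
  have hseg : ∀ n k, ∃ u, u.length = k ∧ p (n + k) = p n ++ u ∧ S.word u (y (n + k)) = y n := by
    intro n k
    induction k with
    | zero => exact ⟨[], rfl, by simp, rfl⟩
    | succ k ih =>
      obtain ⟨u, h1, h2, h3⟩ := ih
      refine ⟨u ++ [i (y (n + k))], by simp [h1], ?_, ?_⟩
      · rw [← add_assoc, hps, h2, List.append_assoc]
      · rw [word_append, Function.comp_apply, ← add_assoc, ← h3]
        congr 1
        exact hyg _
  refine ⟨p, y, rfl, rfl, hyA, fun n => by simp [p], fun n => ?_, hseg⟩
  obtain ⟨u, h1, h2, h3⟩ := hseg 0 n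
  rw [zero_add] at h2 h3
  rw [h2]
  exact h3

/-- stopping time -/
theorem IsAttractor.stopping (hA : S.IsAttractor A) {c : ℝ} (hc : 0 < c)
    (hcA : ∀ i, ∀ b ∈ A, c ≤ ‖deriv (S.g i) b‖)
    {p : ℕ → List (Fin S.m)} {y : ℕ → ℂ} (hp0 : p 0 = []) (hyA : ∀ n, y n ∈ A)
    (hlen : ∀ n, (p n).length = n)
    (hseg : ∀ n k, ∃ u, u.length = k ∧ p (n + k) = p n ++ u ∧ S.word u (y (n + k)) = y n)
    {τ : ℝ} (hτ0 : 0 < τ) (hτ1 : τ ≤ 1) :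
    ∃ n, τ ≤ ‖deriv (S.word (p n)) (y n)‖ ∧ c * ‖deriv (S.word (p n)) (y n)‖ ≤ τ := by
  obtain ⟨C, q, hC, hq0, hq1, hdec⟩ := hA.decayA
  have hex : ∃ n, ‖deriv (S.word (p n)) (y n)‖ < τ := by
    have ht : Tendsto (fun n : ℕ => C * q ^ n) atTop (𝓝 (C * 0)) :=
      (tendsto_pow_atTop_nhds_zero_of_lt_one hq0.le hq1).const_mul C
    rw [mul_zero] at ht
    obtain ⟨n, hn⟩ := (ht.eventually (gt_mem_nhds hτ0)).exists
    refine ⟨n, (hdec _ _ (hyA n)).trans_lt ?_⟩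
    rwa [hlen]
  classical
  have h1 := Nat.find_spec hex
  have h2 := fun m => Nat.find_min (H := hex) (m := m)
  set N := Nat.find hex
  have hN : N ≠ 0 := by
    intro h
    rw [h, hp0] at h1
    simp [word_nil] at h1
    linarith
  obtain ⟨n, hn⟩ := Nat.exists_eq_succ_of_ne_zero hN
  refine ⟨n, not_lt.1 (h2 n (by omega)), ?_⟩
  rw [hn] at h1
  obtain ⟨u, hu1, hu2, hu3⟩ := hseg n 1
  obtain ⟨i, rfl⟩ := List.length_eq_one_iff.1 hu1
  rw [Nat.succ_eq_add_one, hu2, S.deriv_word_append _ _ (hA.2.2.1 (hyA _)), hu3, norm_mul] at h1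
  have h3 : c ≤ ‖deriv (S.word [i]) (y (n + 1))‖ := hcA i _ (hyA _)
  have h4 := mul_le_mul_of_nonneg_left h3 (norm_nonneg (deriv (S.word (p n)) (y n)))
  linarith

theorem IsAttractor.word_compact (hA : S.IsAttractor A) (v) {K : Set ℂ} (hK : IsCompact K)
    (hKA : K ⊆ A) : IsCompact (S.word v '' K) :=
  hK.image_of_continuousOn ((S.word_diff v).continuousOn.mono (hKA.trans hA.2.2.1))

theorem IsAttractor.compl_compact (hA : S.IsAttractor A) (hS : S.SSC A) (v) :
    IsCompact (A \ S.word v '' A) := by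
  induction v with
  | nil => simp [word_nil]
  | cons i v ih =>
    have : A \ S.word (i :: v) '' A =
        (⋃ j ∈ {j | j ≠ i}, S.g j '' A) ∪ S.g i '' (A \ S.word v '' A) := by
      ext z
      constructor
      · rintro ⟨hz, hnz⟩
        obtain ⟨j, y, hy, rfl⟩ := hA.exists_pre hz
        by_cases hji : j = i
        · subst hji
          right
          refine ⟨y, ⟨hy, ?_⟩, rfl⟩
          rintro ⟨x, hx, rfl⟩
          exact hnz ⟨x, hx, rfl⟩
        · left
          exact mem_iUnion₂.2 ⟨j, hji, y, hy, rfl⟩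
      · rintro (h | ⟨y, ⟨hy, hny⟩, rfl⟩)
        · obtain ⟨j, hji, y, hy, rfl⟩ := mem_iUnion₂.1 h
          refine ⟨hA.g_mem j hy, ?_⟩
          rintro ⟨x, hx, e⟩
          exact Set.disjoint_left.1 (hS j i hji) ⟨y, hy, rfl⟩ ⟨_, hA.word_mem v hx, e⟩
        · refine ⟨hA.g_mem i hy, ?_⟩
          rintro ⟨x, hx, e⟩
          apply hny
          exact ⟨x, hx, S.hinj i (hA.2.2.1 (hA.word_mem v hx)) (hA.2.2.1 hy) e⟩
    rw [this]
    refine IsCompact.union ?_ ?_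
    · exact (Set.toFinite _).isCompact_biUnion fun j _ =>
        hA.2.1.image_of_continuousOn ((S.hdiff j).continuousOn.mono hA.2.2.1)
    · exact ih.image_of_continuousOn ((S.hdiff i).continuousOn.mono (sdiff_subset.trans hA.2.2.1))

theorem IsAttractor.cyl_gap (hA : S.IsAttractor A) (hS : S.SSC A) (m : ℕ) :
    ∃ δ > 0, ∀ v : List (Fin S.m), v.length = m → ∀ x ∈ S.word v '' A, ∀ y ∈ A,
      y ∉ S.word v '' A → δ ≤ ‖x - y‖ := by
  have h1 : ∀ v : List (Fin S.m), ∃ δ > 0, ∀ x ∈ S.word v '' A, ∀ y ∈ A,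
      y ∉ S.word v '' A → δ ≤ ‖x - y‖ := by
    intro v
    obtain ⟨δ, h0, h⟩ := (Set.disjoint_sdiff_right (s := S.word v '' A) (t := A)).exists_thickenings
      (hA.word_compact v hA.2.1 subset_rfl) (hA.compl_compact hS v).isClosed
    refine ⟨δ, h0, fun x hx y hy hyn => ?_⟩
    by_contra hlt
    rw [not_le] at hlt
    refine Set.disjoint_left.1 h (self_subset_thickening h0 _ hx) ?_
    exact mem_thickening_iff.2 ⟨y, ⟨hy, hyn⟩, by rwa [dist_eq_norm]⟩
  choose δ hδ0 hδ using h1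
  have hfin : {l : List (Fin S.m) | l.length = m}.Finite := List.finite_length_eq _ _
  have hne : {l : List (Fin S.m) | l.length = m}.Nonempty :=
    ⟨List.replicate m ⟨0, S.hm⟩, by simp⟩
  obtain ⟨v0, hv0, hmin⟩ := hfin.exists_minimalFor δ _ hne
  refine ⟨δ v0, hδ0 v0, fun v hv x hx y hy hyn => ?_⟩
  refine le_trans ?_ (hδ v x hx y hy hyn)
  rcases le_total (δ v0) (δ v) with h | h
  · exact h
  · exact hmin hv h

/-- clopen pieces at all scales -/
theorem IsAttractor.clopen (hA : S.IsAttractor A) (hS : S.SSC A) :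
    ∃ κ s₀ : ℝ, 0 < κ ∧ 0 < s₀ ∧ ∀ a ∈ A, ∀ s, 0 < s → s ≤ s₀ → ∃ P ⊆ A, IsCompact P ∧ a ∈ P ∧
      P ⊆ ball a s ∧ ∀ p ∈ P, ∀ z ∈ A, z ∉ P → κ * s ≤ ‖p - z‖ := by
  obtain ⟨r₀, hr₀, hdist⟩ := hA.distortion (η := 1/2) (by norm_num)
  obtain ⟨r₁, hr₁, hpull⟩ := hA.pullback hS
  obtain ⟨L, ρ, c, -, -, hc0, hc1, hcA, -⟩ := hA.onestep
  obtain ⟨q, hq0, hq1, -, hdiam⟩ := S.contr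
  obtain ⟨C, hC, hdiam⟩ := hdiam A hA.2.1 hA.2.2.1
  set r := min r₀ r₁
  have hr : 0 < r := lt_min hr₀ hr₁
  obtain ⟨hbΩ, hD⟩ := hdist r hr (min_le_left _ _)
  obtain ⟨m, hm⟩ : ∃ m : ℕ, C * q ^ m < r / 16 := by
    have ht : Tendsto (fun n : ℕ => C * q ^ n) atTop (𝓝 (C * 0)) :=
      (tendsto_pow_atTop_nhds_zero_of_lt_one hq0.le hq1).const_mul C
    rw [mul_zero] at ht
    exact (ht.eventually (gt_mem_nhds (by positivity : 0 < r / 16))).exists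
  obtain ⟨δ, hδ, hgap⟩ := hA.cyl_gap hS m
  refine ⟨min (δ / 2) (r / 8) * (c / (2 * r)), 2 * r, by positivity, by positivity, ?_⟩
  intro a ha s hs hs1
  obtain ⟨p, y, hp0, hy0, hyA, hlen, hpy, hseg⟩ := hA.coding ha
  obtain ⟨n, hn1, hn2⟩ := hA.stopping hc0 hcA hp0 hyA hlen hseg (τ := c * s / (2 * r)) (by positivity)
    (by rw [div_le_one (by positivity)]; nlinarith)
  obtain ⟨u, hu1, hu2, hu3⟩ := hseg n m
  set D := deriv (S.word (p n)) (y n) with hDdef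
  have hDne : D ≠ 0 := S.word_deriv_ne _ (hA.2.2.1 (hyA n))
  have hDpos : 0 < ‖D‖ := norm_pos_iff.2 hDne
  have hDs : ‖D‖ * (2 * r) ≤ s := by
    have : c * ‖D‖ * (2 * r) ≤ c * s := by
      rwa [le_div_iff₀ (by positivity)] at hn2
    nlinarith
  have hsD : s * (c / (2 * r)) ≤ ‖D‖ := by
    calc _ = c * s / (2 * r) := by ring
      _ ≤ _ := hn1
  have hynQ : y n ∈ S.word u '' A := ⟨_, hyA _, hu3⟩
  have hQA : S.word u '' A ⊆ A := by rintro _ ⟨x, hx, rfl⟩; exact hA.word_mem u hx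
  have hQd : ∀ x ∈ S.word u '' A, ‖x - y n‖ < r / 16 := by
    rintro _ ⟨x, hx, rfl⟩
    rw [← hu3]
    refine (hdiam u x hx _ (hyA _)).trans_lt ?_
    rwa [hu1]
  have hQb : ∀ x ∈ S.word u '' A, x ∈ ball (y n) r := fun x hx => by
    rw [mem_ball, dist_eq_norm]; linarith [hQd x hx]
  have hup : ∀ x ∈ ball (y n) r, ∀ x' ∈ ball (y n) r,
      ‖S.word (p n) x - S.word (p n) x'‖ ≤ 3/2 * ‖D‖ * ‖x - x'‖ := by
    intro x hx x' hx'
    have h := hD (p n) (y n) (hyA n) x hx x' hx'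
    calc _ = ‖(S.word (p n) x - S.word (p n) x' - D * (x - x')) + D * (x - x')‖ := by congr 1; ring
      _ ≤ _ := norm_add_le _ _
      _ ≤ 1/2 * ‖D‖ * ‖x - x'‖ + ‖D‖ * ‖x - x'‖ := by rw [norm_mul]; gcongr
      _ = _ := by ring
  have hlow : ∀ x ∈ ball (y n) r, ∀ x' ∈ ball (y n) r,
      1/2 * ‖D‖ * ‖x - x'‖ ≤ ‖S.word (p n) x - S.word (p n) x'‖ := by
    intro x hx x' hx'
    have h := hD (p n) (y n) (hyA n) x hx x' hx'
    have : ‖D‖ * ‖x - x'‖ ≤ ‖S.word (p n) x - S.word (p n) x'‖ + 1/2 * ‖D‖ * ‖x - x'‖ := by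
      calc _ = ‖(S.word (p n) x - S.word (p n) x') -
            (S.word (p n) x - S.word (p n) x' - D * (x - x'))‖ := by
              rw [← norm_mul]; congr 1; ring
        _ ≤ _ := norm_sub_le _ _
        _ ≤ _ := by gcongr
    linarith
  have hyb : y n ∈ ball (y n) r := mem_ball_self hr
  have hPa : ∀ x ∈ S.word u '' A, ‖S.word (p n) x - a‖ ≤ ‖D‖ * r / 8 := by
    intro x hx
    have h := hup x (hQb x hx) (y n) hyb
    rw [hpy] at h
    have := hQd x hx
    calc _ ≤ _ := h
      _ ≤ 3/2 * ‖D‖ * (r / 16) := by gcongr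
      _ ≤ _ := by nlinarith [mul_pos hDpos hr]
  refine ⟨S.word (p n) '' (S.word u '' A), ?_, ?_, ⟨y n, hynQ, hpy n⟩, ?_, ?_⟩
  · rintro _ ⟨x, hx, rfl⟩; exact hA.word_mem _ (hQA hx)
  · exact hA.word_compact _ (hA.word_compact _ hA.2.1 subset_rfl) hQA
  · rintro _ ⟨x, hx, rfl⟩
    rw [mem_ball, dist_eq_norm]
    have := hPa x hx
    nlinarith [mul_pos hDpos hr]
  · rintro _ ⟨x, hx, rfl⟩ z hz hzP
    have hmain : min (δ / 2) (r / 8) * ‖D‖ ≤ ‖S.word (p n) x - z‖ := by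
      by_cases hza : ‖z - a‖ ≤ ‖D‖ * (r / 2) / 2
      · rw [← hpy n] at hza
        obtain ⟨x', hx', rfl⟩ := surj_of_approx hDne (by norm_num) le_rfl (by positivity)
          (by linarith : r / 2 < r) (hD (p n) (y n) (hyA n)) hza
        have hx'b : x' ∈ ball (y n) r := by rw [mem_ball, dist_eq_norm]; linarith
        have hx'A : x' ∈ A := hpull (p n) (y n) (hyA n) x'
          (ball_subset_ball (min_le_right _ _) hx'b) hz
        have hx'Q : x' ∉ S.word u '' A := fun h => hzP ⟨x', h, rfl⟩
        have h1 := hgap u hu1 x hx x' hx'A hx'Q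
        calc _ ≤ δ / 2 * ‖D‖ := by gcongr; exact min_le_left _ _
          _ = 1/2 * ‖D‖ * δ := by ring
          _ ≤ 1/2 * ‖D‖ * ‖x - x'‖ := by gcongr
          _ ≤ _ := hlow x (hQb x hx) x' hx'b
      · rw [not_le] at hza
        have h1 := hPa x hx
        have h2 : ‖z - a‖ ≤ ‖S.word (p n) x - a‖ + ‖S.word (p n) x - z‖ := by
          calc ‖z - a‖ = ‖(S.word (p n) x - a) - (S.word (p n) x - z)‖ := by congr 1; ring
            _ ≤ _ := norm_sub_le _ _
        calc _ ≤ r / 8 * ‖D‖ := by gcongr; exact min_le_right _ _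
          _ ≤ _ := by linarith
    calc _ = min (δ / 2) (r / 8) * (s * (c / (2 * r))) := by ring
      _ ≤ min (δ / 2) (r / 8) * ‖D‖ := by gcongr
      _ ≤ _ := hmain

end HolIFS


theorem rigid {A : Set ℂ} {κ s₀ c η R R' R'' : ℝ} {β μ₁ μ₂ : ℂ} {h₁ h₂ : ℂ → ℂ}
    (hcl : ∀ a ∈ A, ∀ s, 0 < s → s ≤ s₀ → ∃ P ⊆ A, IsCompact P ∧ a ∈ P ∧
      P ⊆ ball a s ∧ ∀ p ∈ P, ∀ z ∈ A, z ∉ P → κ * s ≤ ‖p - z‖)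
    (hc1 : c ≤ 1) (hη0 : 0 < η) (hη1 : 8 * η ≤ c) (hη2 : 54 * η < c * κ)
    (hβ : β ∈ A)
    (hμc : c ≤ ‖μ₁‖) (hμ1 : ‖μ₁‖ ≤ 1) (hμ : ‖μ₁ - μ₂‖ ≤ η)
    (hm : ∀ z ∈ A, z ∈ ball β R → h₂ z ∈ A)
    (hl₁ : ∀ z ∈ A, z ∈ ball β R → ∀ z' ∈ A, z' ∈ ball β R →
      ‖h₁ z - h₁ z' - μ₁ * (z - z')‖ ≤ 4 * η * ‖z - z'‖)
    (hl₂ : ∀ z ∈ A, z ∈ ball β R → ∀ z' ∈ A, z' ∈ ball β R →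
      ‖h₂ z - h₂ z' - μ₂ * (z - z')‖ ≤ 4 * η * ‖z - z'‖)
    (hop : ∀ p ∈ A, ‖p - h₁ β‖ < R' → ∃ z ∈ A, z ∈ ball β R ∧ h₁ z = p)
    (hε : ‖h₂ β - h₁ β‖ ≤ η * R'') (hR0 : 0 < R'') (hR1 : R'' ≤ s₀) (hR2 : 2 * R'' ≤ R)
    (hR3 : 12 * R'' ≤ R') :
    ∀ a ∈ A, a ∈ ball β R'' → h₁ a = h₂ a := by
  have hlu : ∀ z ∈ A, z ∈ ball β R → ∀ z' ∈ A, z' ∈ ball β R →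
      ‖(h₂ z - h₁ z) - (h₂ z' - h₁ z')‖ ≤ 9 * η * ‖z - z'‖ := by
    intro z hz hzb z' hz' hzb'
    have e1 := hl₁ z hz hzb z' hz' hzb'
    have e2 := hl₂ z hz hzb z' hz' hzb'
    calc _ = ‖(h₂ z - h₂ z' - μ₂ * (z - z')) - (h₁ z - h₁ z' - μ₁ * (z - z'))
          - (μ₁ - μ₂) * (z - z')‖ := by congr 1; ring
      _ ≤ ‖(h₂ z - h₂ z' - μ₂ * (z - z')) - (h₁ z - h₁ z' - μ₁ * (z - z'))‖
          + ‖(μ₁ - μ₂) * (z - z')‖ := norm_sub_le _ _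
      _ ≤ (4 * η * ‖z - z'‖ + 4 * η * ‖z - z'‖) + η * ‖z - z'‖ := by
          refine add_le_add ((norm_sub_le _ _).trans (add_le_add e2 e1)) ?_
          rw [norm_mul]; gcongr
      _ = _ := by ring
  have hup : ∀ z ∈ A, z ∈ ball β R → ∀ z' ∈ A, z' ∈ ball β R →
      ‖h₁ z - h₁ z'‖ ≤ 2 * ‖z - z'‖ := by
    intro z hz hzb z' hz' hzb'
    have e1 := hl₁ z hz hzb z' hz' hzb'
    calc _ = ‖(h₁ z - h₁ z' - μ₁ * (z - z')) + μ₁ * (z - z')‖ := by congr 1; ring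
      _ ≤ _ := norm_add_le _ _
      _ ≤ 4 * η * ‖z - z'‖ + 1 * ‖z - z'‖ := by rw [norm_mul]; gcongr
      _ ≤ _ := by nlinarith [norm_nonneg (z - z')]
  have hlow : ∀ z ∈ A, z ∈ ball β R → ∀ z' ∈ A, z' ∈ ball β R →
      c / 2 * ‖z - z'‖ ≤ ‖h₁ z - h₁ z'‖ := by
    intro z hz hzb z' hz' hzb'
    have e1 := hl₁ z hz hzb z' hz' hzb'
    have : ‖μ₁‖ * ‖z - z'‖ ≤ ‖h₁ z - h₁ z'‖ + 4 * η * ‖z - z'‖ := by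
      calc _ = ‖(h₁ z - h₁ z') - (h₁ z - h₁ z' - μ₁ * (z - z'))‖ := by
              rw [← norm_mul]; congr 1; ring
        _ ≤ _ := norm_sub_le _ _
        _ ≤ _ := by gcongr
    nlinarith [norm_nonneg (z - z')]
  have hRpos : 0 < R := by linarith
  have hββ : β ∈ ball β R := mem_ball_self hRpos
  intro a ha haR
  by_contra hne
  set U := h₂ a - h₁ a with hU
  have hUne : U ≠ 0 := sub_ne_zero.2 (Ne.symm hne)
  have hUpos : 0 < ‖U‖ := norm_pos_iff.2 hUne
  have haβ : ‖a - β‖ < R'' := by rw [← dist_eq_norm]; exact haR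
  have haR' : a ∈ ball β R := ball_subset_ball (by linarith) haR
  have hUle : ‖U‖ ≤ 10 * η * R'' := by
    have e := hlu a ha haR' β hβ hββ
    calc ‖U‖ = ‖(h₂ a - h₁ a - (h₂ β - h₁ β)) + (h₂ β - h₁ β)‖ := by congr 1; rw [hU]; ring
      _ ≤ _ := norm_add_le _ _
      _ ≤ 9 * η * R'' + η * R'' := by
          refine add_le_add (e.trans ?_) hε
          gcongr
      _ = _ := by ring
  set s := ‖U‖ / (18 * η) with hs
  have hsU : ‖U‖ = 18 * η * s := by rw [hs]; field_simp
  have hs0 : 0 < s := by positivity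
  have hsR : s ≤ R'' := by
    rw [hs, div_le_iff₀ (by positivity)]; nlinarith
  obtain ⟨P, hPA, hPc, haP, hPb, hPgap⟩ := hcl a ha s hs0 (hsR.trans hR1)
  have hPR : ∀ x ∈ P, x ∈ ball β R ∧ ‖x - a‖ < s ∧ ‖x - β‖ < 2 * R'' := by
    intro x hx
    have h1 : ‖x - a‖ < s := by rw [← dist_eq_norm]; exact hPb hx
    have h2 : ‖x - β‖ < 2 * R'' := by
      calc _ ≤ ‖x - a‖ + ‖a - β‖ := norm_sub_le_norm_sub_add_norm_sub _ _ _
        _ < _ := by linarith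
    exact ⟨by rw [mem_ball, dist_eq_norm]; linarith, h1, h2⟩
  have hcont : ContinuousOn h₁ P := by
    have : LipschitzOnWith 2 h₁ P := by
      apply LipschitzOnWith.of_dist_le_mul
      intro x hx y hy
      rw [dist_eq_norm, dist_eq_norm]
      exact hup x (hPA hx) (hPR x hx).1 y (hPA hy) (hPR y hy).1
    exact this.continuousOn
  have hcont2 : ContinuousOn (fun x => (h₁ x * (starRingEnd ℂ) U).re) P :=
    Complex.continuous_re.comp_continuousOn (hcont.mul continuousOn_const)
  obtain ⟨x, hxP, hmax⟩ := hPc.exists_isMaxOn ⟨a, haP⟩ hcont2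
  obtain ⟨hxR, hxa, hxβ⟩ := hPR x hxP
  have hux : ‖(h₂ x - h₁ x) - U‖ ≤ ‖U‖ / 2 := by
    have e := hlu x (hPA hxP) hxR a ha haR'
    calc _ ≤ _ := e
      _ ≤ 9 * η * s := by gcongr
      _ = _ := by rw [hsU]; ring
  have huxn : ‖h₂ x - h₁ x‖ ≤ 3 / 2 * ‖U‖ := by
    calc _ = ‖((h₂ x - h₁ x) - U) + U‖ := by congr 1; ring
      _ ≤ _ := norm_add_le _ _
      _ ≤ _ := by linarith
  have hη8 : η ≤ 1 / 8 := by linarith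
  obtain ⟨z, hzA, hzR, hz⟩ := hop (h₂ x) (hm x (hPA hxP) hxR) (by
    have e := hup x (hPA hxP) hxR β hβ hββ
    calc _ ≤ ‖h₂ x - h₁ x‖ + ‖h₁ x - h₁ β‖ := norm_sub_le_norm_sub_add_norm_sub _ _ _
      _ ≤ 3 / 2 * (10 * η * R'') + 2 * ‖x - β‖ := by gcongr; linarith
      _ < R' := by nlinarith)
  have hzP : z ∈ P := by
    by_contra hzP
    have e1 := hPgap x hxP z hzA hzP
    have e2 := hlow z hzA hzR x (hPA hxP) hxR
    rw [hz, norm_sub_rev z x] at e2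
    have hcpos : 0 < c := by linarith
    have e3 : c / 2 * (κ * s) ≤ c / 2 * ‖x - z‖ := by gcongr
    have e4 : c / 2 * (κ * s) ≤ 27 * η * s := by
      calc _ ≤ _ := e3
        _ ≤ _ := e2
        _ ≤ _ := huxn
        _ = _ := by rw [hsU]; ring
    nlinarith
  have e1 : (h₁ z * (starRingEnd ℂ) U).re ≤ (h₁ x * (starRingEnd ℂ) U).re := hmax hzP
  rw [hz] at e1
  have e2 : (h₂ x * (starRingEnd ℂ) U).re - (h₁ x * (starRingEnd ℂ) U).re
      = ‖U‖ ^ 2 + (((h₂ x - h₁ x) - U) * (starRingEnd ℂ) U).re := by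
    have : (U * (starRingEnd ℂ) U).re = ‖U‖ ^ 2 := by
      rw [Complex.mul_conj, Complex.normSq_eq_norm_sq, Complex.ofReal_re]
    rw [← this, ← Complex.sub_re, ← Complex.add_re]
    congr 1; ring
  have e3 : |(((h₂ x - h₁ x) - U) * (starRingEnd ℂ) U).re| ≤ ‖U‖ / 2 * ‖U‖ := by
    refine (Complex.abs_re_le_norm _).trans ?_
    rw [norm_mul, RCLike.norm_conj]
    gcongr
  have := (abs_le.1 e3).1
  nlinarith

theorem ratio_tendsto {f g h : ℂ → ℂ} {y β Df Dg : ℂ} {l : Filter ℂ} (hl : l ≤ 𝓝[≠] β)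
    (hf : HasDerivAt f Df y) (hg : HasDerivAt g Dg β) (hDf : Df ≠ 0)
    (hh : Tendsto h l (𝓝[≠] y)) (e0 : f y = g β) (e : ∀ᶠ z in l, f (h z) = g z) :
    Tendsto (fun z => (h z - y) / (z - β)) l (𝓝 (Dg / Df)) := by
  have h1 : Tendsto (fun z => slope f y (h z)) l (𝓝 Df) := hf.tendsto_slope.comp hh
  have h2 : Tendsto (fun z => slope g β z) l (𝓝 Dg) := hg.tendsto_slope.mono_left hl
  refine (h2.div h1 hDf).congr' ?_
  filter_upwards [e, h1.eventually_ne hDf, hh self_mem_nhdsWithin, hl self_mem_nhdsWithin]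
    with z e1 e2 e3 e4
  have e3' : h z - y ≠ 0 := sub_ne_zero.2 e3
  have e4' : z - β ≠ 0 := sub_ne_zero.2 e4
  simp only [Pi.div_apply, slope_def_field, e1, e0] at e2 ⊢
  have e5 : g z - g β ≠ 0 := by
    intro h; rw [h, zero_div] at e2; exact e2 rfl
  field_simp

namespace HolIFS
variable {S : HolIFS} {A : Set ℂ}

theorem exists_pow_word (S : HolIFS) (w : List (Fin S.m)) {β : ℂ} (hβ : β ∈ S.Ω) (hfix : S.word w β = β) (k : ℕ) :
    ∃ W : List (Fin S.m), W.length = k * w.length ∧ S.word W β = β ∧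
      deriv (S.word W) β = deriv (S.word w) β ^ k := by
  induction k with
  | zero => exact ⟨[], by simp, rfl, by simp [word_nil]⟩
  | succ k ih =>
    obtain ⟨W, h1, h2, h3⟩ := ih
    refine ⟨W ++ w, by rw [List.length_append, h1]; ring, ?_, ?_⟩
    · rw [word_append, Function.comp_apply, hfix, h2]
    · rw [S.deriv_word_append _ _ hβ, hfix, h3, pow_succ]

theorem tendsto_aux {C q : ℝ} (hq0 : 0 < q) (hq1 : q < 1) {n : ℕ} (hn : n ≠ 0) :
    Tendsto (fun k : ℕ => C * q ^ (k * n)) atTop (𝓝 0) := by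
  have : Tendsto (fun k : ℕ => C * (q ^ n) ^ k) atTop (𝓝 (C * 0)) :=
      (tendsto_pow_atTop_nhds_zero_of_lt_one (by positivity)
        (pow_lt_one₀ hq0.le hq1 hn)).const_mul C
  rw [mul_zero] at this
  refine this.congr fun k => ?_
  rw [mul_comm k n, pow_mul]

theorem IsAttractor.fixed (hA : S.IsAttractor A) {w : List (Fin S.m)} (hw : w ≠ []) {β : ℂ}
    (hβ : β ∈ S.Ω) (hfix : S.word w β = β) : β ∈ A ∧ ‖deriv (S.word w) β‖ < 1 := by
  have hwl : w.length ≠ 0 := fun h => hw (List.length_eq_zero_iff.1 h)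
  obtain ⟨a, ha⟩ := hA.1
  choose W hW1 hW2 hW3 using S.exists_pow_word w hβ hfix
  have hβA : β ∈ A := by
    obtain ⟨q, hq0, hq1, -, hd⟩ := S.contr
    obtain ⟨C, hC, hd⟩ := hd {β, a} (Set.toFinite _).isCompact
      (by rintro x (rfl | rfl); exacts [hβ, hA.2.2.1 ha])
    rw [← hA.2.1.isClosed.closure_eq, Metric.mem_closure_iff]
    intro ε hε
    obtain ⟨k, hk⟩ := ((tendsto_aux (C := C) hq0 hq1 hwl).eventually (gt_mem_nhds hε)).exists
    refine ⟨S.word (W k) a, hA.word_mem _ ha, ?_⟩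
    have := hd (W k) β (by simp) a (by simp)
    rw [hW2, hW1] at this
    rw [dist_eq_norm]; linarith
  refine ⟨hβA, ?_⟩
  by_contra h
  rw [not_lt] at h
  obtain ⟨C, q, hC, hq0, hq1, hdec⟩ := hA.decayA
  obtain ⟨k, hk⟩ := ((tendsto_aux (C := C) hq0 hq1 hwl).eventually (gt_mem_nhds one_pos)).exists
  have h1 := hdec (W k) β hβA
  rw [hW1, hW3, norm_pow] at h1
  have := one_le_pow₀ h (n := k)
  linarith

theorem IsAttractor.accum (hA : S.IsAttractor A) (hA2 : A.Nontrivial) {w : List (Fin S.m)}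
    (hw : w ≠ []) {β : ℂ} (hβA : β ∈ A) (hfix : S.word w β = β) :
    (𝓝[A \ {β}] β).NeBot := by
  have hβ := hA.2.2.1 hβA
  have hwl : w.length ≠ 0 := fun h => hw (List.length_eq_zero_iff.1 h)
  obtain ⟨a, ha, hne⟩ := hA2.exists_ne β
  choose W hW1 hW2 hW3 using S.exists_pow_word w hβ hfix
  obtain ⟨q, hq0, hq1, -, hd⟩ := S.contr
  obtain ⟨C, hC, hd⟩ := hd A hA.2.1 hA.2.2.1
  rw [← mem_closure_iff_nhdsWithin_neBot, Metric.mem_closure_iff]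
  intro ε hε
  obtain ⟨k, hk⟩ := ((tendsto_aux (C := C) hq0 hq1 hwl).eventually (gt_mem_nhds hε)).exists
  refine ⟨S.word (W k) a, ⟨hA.word_mem _ ha, ?_⟩, ?_⟩
  · intro h
    have h : S.word (W k) a = β := h
    exact hne (S.word_inj _ (hA.2.2.1 ha) hβ (h.trans (hW2 k).symm))
  · have := hd (W k) β hβA a ha
    rw [hW2, hW1] at this
    rw [dist_eq_norm]; linarith

end HolIFS


theorem sym_abs {A : Set ℂ} {f g : ℂ → ℂ} {y β Df Dg : ℂ} {c η r : ℝ}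
    (hDf : Df ≠ 0) (hDg : Dg ≠ 0) (hτ : ‖Dg‖ ≤ ‖Df‖) (hcτ : c * ‖Df‖ ≤ ‖Dg‖) (hc0 : 0 < c) (hc1 : c ≤ 1)
    (hη0 : 0 < η) (hη1 : η ≤ 1 / 8) (hr : 0 < r)
    (hfd : ∀ x ∈ ball y r, ∀ x' ∈ ball y r, ‖f x - f x' - Df * (x - x')‖ ≤ η * ‖Df‖ * ‖x - x'‖)
    (hgd : ∀ x ∈ ball β r, ∀ x' ∈ ball β r, ‖g x - g x' - Dg * (x - x')‖ ≤ η * ‖Dg‖ * ‖x - x'‖)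
    (hfp : ∀ x ∈ ball y r, f x ∈ A → x ∈ A) (hgp : ∀ x ∈ ball β r, g x ∈ A → x ∈ A)
    (hfm : ∀ x ∈ A, f x ∈ A) (hgm : ∀ x ∈ A, g x ∈ A)
    (hfi : InjOn f (ball y r)) (hβ : β ∈ A) (e0 : f y = β) (e1 : g β = β) :
    ∃ h : ℂ → ℂ, h β = y ∧ (∀ z ∈ A, z ∈ ball β (r / 8) → h z ∈ A ∧ f (h z) = g z) ∧
      (∀ z ∈ A, z ∈ ball β (r / 8) → ∀ z' ∈ A, z' ∈ ball β (r / 8) →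
        ‖h z - h z' - Dg / Df * (z - z')‖ ≤ 4 * η * ‖z - z'‖) ∧
      (∀ p ∈ A, ‖p - h β‖ < c * (r / 8) / 6 → ∃ z ∈ A, z ∈ ball β (r / 8) ∧ h z = p) := by
  have hF : 0 < ‖Df‖ := norm_pos_iff.2 hDf
  have hG : 0 < ‖Dg‖ := norm_pos_iff.2 hDg
  have up : ∀ {f : ℂ → ℂ} {y D : ℂ}, (∀ x ∈ ball y r, ∀ x' ∈ ball y r,
      ‖f x - f x' - D * (x - x')‖ ≤ η * ‖D‖ * ‖x - x'‖) → ∀ x ∈ ball y r, ∀ x' ∈ ball y r,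
      ‖f x - f x'‖ ≤ 2 * ‖D‖ * ‖x - x'‖ := by
    intro f y D h x hx x' hx'
    have e := h x hx x' hx'
    calc _ = ‖(f x - f x' - D * (x - x')) + D * (x - x')‖ := by congr 1; ring
      _ ≤ _ := norm_add_le _ _
      _ ≤ η * ‖D‖ * ‖x - x'‖ + ‖D‖ * ‖x - x'‖ := by rw [norm_mul]; gcongr
      _ ≤ _ := by nlinarith [mul_nonneg (norm_nonneg D) (norm_nonneg (x - x'))]
  have hyb : y ∈ ball y r := mem_ball_self hr
  have hβb : β ∈ ball β r := mem_ball_self hr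
  have hβb8 : β ∈ ball β (r / 8) := mem_ball_self (by linarith)
  have sub8 : ∀ {z}, z ∈ ball β (r / 8) → z ∈ ball β r := fun hz =>
    ball_subset_ball (by linarith) hz
  have hex : ∀ z : ℂ, ∃ x, z ∈ ball β (r / 8) → x ∈ ball y r ∧ f x = g z := by
    intro z
    by_cases hz : z ∈ ball β (r / 8)
    · have hz' : ‖z - β‖ < r / 8 := by rw [← dist_eq_norm]; exact hz
      have h1 := up hgd z (sub8 hz) β hβb
      obtain ⟨x, hx, hx'⟩ := surj_of_approx (f := f) (p := g z) (s := r / 2) hDf hη0.le (by linarith)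
        (by linarith) (by linarith) hfd (by
          rw [e0]; rw [e1] at h1
          refine h1.trans ?_
          have : ‖Dg‖ * ‖z - β‖ ≤ ‖Df‖ * (r / 8) := by gcongr
          linarith)
      refine ⟨x, fun _ => ⟨?_, hx'⟩⟩
      rw [mem_ball, dist_eq_norm]; linarith
    · exact ⟨0, fun h => absurd h hz⟩
  choose h hh using hex
  have hhβ : h β = y := hfi (hh β hβb8).1 hyb (by rw [(hh β hβb8).2, e0, e1])
  refine ⟨h, hhβ, fun z hz hzb => ⟨hfp _ (hh z hzb).1 ?_, (hh z hzb).2⟩, ?_, ?_⟩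
  · rw [(hh z hzb).2]; exact hgm z hz
  · intro z hz hzb z' hz' hzb'
    have a1 := hfd _ (hh z hzb).1 _ (hh z' hzb').1
    have a2 := hgd z (sub8 hzb) z' (sub8 hzb')
    have a3 := up hgd z (sub8 hzb) z' (sub8 hzb')
    rw [(hh z hzb).2, (hh z' hzb').2] at a1
    set X := h z - h z'
    set Y := z - z'
    set T := g z - g z'
    have b1 : ‖Df‖ * ‖X‖ ≤ ‖T‖ + η * ‖Df‖ * ‖X‖ := by
      calc _ = ‖T - (T - Df * X)‖ := by rw [← norm_mul]; congr 1; ring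
        _ ≤ _ := norm_sub_le _ _
        _ ≤ _ := by gcongr
    have b2 : ‖Df‖ * ‖X‖ ≤ ‖Df‖ * (3 * ‖Y‖) := by
      have := mul_le_mul_of_nonneg_right hη1 (mul_nonneg hF.le (norm_nonneg X))
      have : ‖Dg‖ * ‖Y‖ ≤ ‖Df‖ * ‖Y‖ := by gcongr
      have : 0 ≤ ‖Df‖ * ‖Y‖ := by positivity
      linarith
    have b3 : ‖X‖ ≤ 3 * ‖Y‖ := le_of_mul_le_mul_left b2 hF
    have b4 : ‖Df‖ * ‖X - Dg / Df * Y‖ ≤ ‖Df‖ * (4 * η * ‖Y‖) := by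
      calc _ = ‖(T - Dg * Y) - (T - Df * X)‖ := by
            rw [← norm_mul]; congr 1; field_simp; ring
        _ ≤ _ := norm_sub_le _ _
        _ ≤ η * ‖Dg‖ * ‖Y‖ + η * ‖Df‖ * ‖X‖ := add_le_add a2 a1
        _ ≤ η * ‖Df‖ * ‖Y‖ + η * ‖Df‖ * (3 * ‖Y‖) := by gcongr
        _ = _ := by ring
    exact le_of_mul_le_mul_left b4 hF
  · intro p hp hpb
    rw [hhβ] at hpb
    have hcr : c * (r / 8) / 6 ≤ r / 8 := by nlinarith
    have hpy : p ∈ ball y r := by rw [mem_ball, dist_eq_norm]; linarith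
    have a1 := up hfd p hpy y hyb
    rw [e0] at a1
    have a2 : ‖f p - β‖ ≤ ‖Dg‖ * (r / 9) / 2 := by
      have b1 : ‖Df‖ * ‖p - y‖ ≤ ‖Df‖ * (c * (r / 8) / 6) := by gcongr
      have b2 : c * ‖Df‖ * r ≤ ‖Dg‖ * r := by gcongr
      have b3 : 0 < ‖Dg‖ * r := by positivity
      nlinarith
    obtain ⟨z, hz, hzp⟩ := surj_of_approx (f := g) (p := f p) (s := r / 9) hDg hη0.le (by linarith)
        (by linarith) (by linarith) hgd (by rw [e1]; exact a2)
    have hz8 : z ∈ ball β (r / 8) := by rw [mem_ball, dist_eq_norm]; linarith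
    refine ⟨z, hgp z (sub8 hz8) (by rw [hzp]; exact hfm p hp), hz8, ?_⟩
    exact hfi (hh z hz8).1 hpy (by rw [(hh z hz8).2, hzp])

theorem pigeon {A : Set ℂ} (hA : IsCompact A) {ε : ℝ} (hε : 0 < ε) :
    ∃ N : ℕ, ∀ (μ y : ℕ → ℂ), (∀ k, ‖μ k‖ ≤ 1) → (∀ k, y k ∈ A) →
      ∃ k k', k < k' ∧ k' ≤ N ∧ ‖μ k - μ k'‖ ≤ ε ∧ ‖y k' - y k‖ ≤ ε := by
  have hK : IsCompact (closedBall (0 : ℂ) 1 ×ˢ A) := (isCompact_closedBall _ _).prod hA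
  obtain ⟨t, -, htf, ht⟩ := hK.finite_cover_balls (half_pos hε)
  refine ⟨htf.toFinset.card, fun μ y hμ hy => ?_⟩
  have hx : ∀ k, ∃ x ∈ htf.toFinset, (μ k, y k) ∈ ball x (ε / 2) := by
    intro k
    have := ht (show (μ k, y k) ∈ closedBall (0 : ℂ) 1 ×ˢ A from ⟨by simpa using hμ k, hy k⟩)
    simpa using this
  choose x hxt hxb using hx
  obtain ⟨a, ha, b, hb, hne, hab⟩ := Finset.exists_ne_map_eq_of_card_lt_of_maps_to
    (s := Finset.range (htf.toFinset.card + 1)) (t := htf.toFinset) (f := x) (by simp)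
    (fun k _ => hxt k)
  have key : ∀ a b, x a = x b → ‖μ a - μ b‖ ≤ ε ∧ ‖y b - y a‖ ≤ ε := by
    intro a b hab
    have h1 := hxb a
    have h2 := hxb b
    rw [hab] at h1
    have h3 : dist (μ a, y a) (μ b, y b) ≤ ε := by
      have := dist_triangle_right (μ a, y a) (μ b, y b) (x b)
      rw [mem_ball] at h1 h2
      linarith
    rw [Prod.dist_eq] at h3
    refine ⟨?_, ?_⟩
    · rw [← dist_eq_norm]; exact (le_max_left _ _).trans h3
    · rw [← dist_eq_norm, dist_comm]; exact (le_max_right _ _).trans h3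
  rw [Finset.mem_range] at ha hb
  rcases lt_or_gt_of_ne hne with h | h
  · exact ⟨a, b, h, by omega, key a b hab⟩
  · exact ⟨b, a, h, by omega, key b a hab.symm⟩

namespace HolIFS

theorem oneway (G F : HolIFS) (A : Set ℂ)
    (hAg : G.IsAttractor A) (hAf : F.IsAttractor A) (hA2 : A.Nontrivial)
    (hSSCg : G.SSC A) (hSSCf : F.SSC A) :
    ∃ N : ℕ, ∀ lam ∈ G.spectrum, ∃ l : ℕ, 1 ≤ l ∧ l ≤ N ∧ lam ^ l ∈ F.spectrum := by
  obtain ⟨κ, s₀, hκ, hs₀, hcl⟩ := hAg.clopen hSSCg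
  obtain ⟨-, -, c, -, -, hc0, hc1, hcA, -⟩ := hAf.onestep
  obtain ⟨η, hη0, hη8, hη54⟩ : ∃ η : ℝ, 0 < η ∧ 8 * η ≤ c ∧ 54 * η < c * κ := by
    have hcκ : 0 < c * κ := by positivity
    refine ⟨min (c / 8) (c * κ / 60), by positivity, ?_, ?_⟩
    · have := min_le_left (c / 8) (c * κ / 60); linarith
    · have := min_le_right (c / 8) (c * κ / 60); linarith
  obtain ⟨r1, hr1, hd1⟩ := hAg.distortion hη0
  obtain ⟨r2, hr2, hd2⟩ := hAf.distortion hη0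
  obtain ⟨r3, hr3, hp1⟩ := hAg.pullback hSSCg
  obtain ⟨r4, hr4, hp2⟩ := hAf.pullback hSSCf
  obtain ⟨r, hr, hle1, hle2, hle3, hle4⟩ : ∃ r, 0 < r ∧ r ≤ r1 ∧ r ≤ r2 ∧ r ≤ r3 ∧ r ≤ r4 :=
    ⟨min (min r1 r2) (min r3 r4), by positivity, by simp, by simp, by simp, by simp⟩
  obtain ⟨-, hd1⟩ := hd1 r hr hle1
  obtain ⟨hΩ2, hd2⟩ := hd2 r hr hle2
  obtain ⟨R, hR, hRs, hRc⟩ : ∃ R, 0 < R ∧ R ≤ s₀ ∧ R ≤ c * (r / 8) / 80 :=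
    ⟨min s₀ (c * (r / 8) / 80), by positivity, min_le_left _ _, min_le_right _ _⟩
  have hcr : c * (r / 8) ≤ r / 8 := by nlinarith
  obtain ⟨N, hN⟩ := pigeon hAg.2.1 (ε := min η (η * R)) (by positivity)
  refine ⟨N, ?_⟩
  rintro lam ⟨w, β, hw, hβΩ, hfix, hlam⟩
  obtain ⟨hβA, hlam1⟩ := hAg.fixed hw hβΩ hfix
  have hlam0 : lam ≠ 0 := by rw [← hlam]; exact G.word_deriv_ne w hβΩ
  rw [hlam] at hlam1
  have hlamp : 0 < ‖lam‖ := norm_pos_iff.2 hlam0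
  have hacc := hAg.accum hA2 hw hβA hfix
  choose W hW1 hW2 hW3 using G.exists_pow_word w hβΩ hfix
  rw [hlam] at hW3
  obtain ⟨p, y, hp0, hy0, hyA, hlen, hpy, hseg⟩ := hAf.coding hβA
  have hst : ∀ k : ℕ, ∃ n, ‖lam ^ k‖ ≤ ‖deriv (F.word (p n)) (y n)‖ ∧
      c * ‖deriv (F.word (p n)) (y n)‖ ≤ ‖lam ^ k‖ := fun k =>
    hAf.stopping hc0 hcA hp0 hyA hlen hseg (norm_pos_iff.2 (pow_ne_zero _ hlam0))
      (by rw [norm_pow]; exact pow_le_one₀ (norm_nonneg _) hlam1.le)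
  choose n hn1 hn2 using hst
  have hDfne : ∀ k, deriv (F.word (p k)) (y k) ≠ 0 := fun k =>
    F.word_deriv_ne _ (hAf.2.2.1 (hyA k))
  have hsym := fun k => sym_abs (A := A) (f := F.word (p (n k))) (g := G.word (W k)) (y := y (n k))
    (β := β) (Df := deriv (F.word (p (n k))) (y (n k))) (Dg := lam ^ k) (c := c) (η := η) (r := r)
    (hDfne _) (pow_ne_zero _ hlam0) (hn1 k) (hn2 k) hc0 hc1 hη0 (by linarith) hr
    (hd2 _ _ (hyA _)) (by have := hd1 (W k) β hβA; rwa [hW3] at this)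
    (fun x hx => hp2 _ _ (hyA _) x (ball_subset_ball hle4 hx))
    (fun x hx => hp1 _ _ hβA x (ball_subset_ball hle3 hx))
    (fun x hx => hAf.word_mem _ hx) (fun x hx => hAg.word_mem _ hx)
    ((F.word_inj _).mono (hΩ2 _ (hyA _))) hβA (hpy _) (hW2 k)
  choose h hhβ hhA hhl hho using hsym
  have hμ : ∀ k, c ≤ ‖lam ^ k / deriv (F.word (p (n k))) (y (n k))‖ ∧
      ‖lam ^ k / deriv (F.word (p (n k))) (y (n k))‖ ≤ 1 := by
    intro k
    have := norm_pos_iff.2 (hDfne (n k))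
    rw [norm_div]
    exact ⟨(le_div_iff₀ this).2 (hn2 k), (div_le_one this).2 (hn1 k)⟩
  obtain ⟨k, k', hkk, hkN, hμd, hyd⟩ := hN
    (fun k => lam ^ k / deriv (F.word (p (n k))) (y (n k))) (fun k => y (n k))
    (fun k => (hμ k).2) (fun k => hyA _)
  have hrig := rigid (R := r / 8) (R' := c * (r / 8) / 6) (R'' := R) (h₁ := h k) (h₂ := h k') hcl hc1
    hη0 hη8 hη54 hβA (hμ k).1 (hμ k).2 (hμd.trans (min_le_left _ _))
    (fun z hz hzb => (hhA k' z hz hzb).1) (hhl k) (hhl k') (hho k)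
    (by rw [hhβ, hhβ]; exact hyd.trans (min_le_right _ _)) hR hRs (by linarith) (by linarith)
  have hyy : y (n k) = y (n k') := by
    rw [← hhβ k, ← hhβ k']; exact hrig β hβA (mem_ball_self hR)
  set l : Filter ℂ := 𝓝[A \ {β}] β with hl
  have hlne : l ≤ 𝓝[≠] β := nhdsWithin_mono _ (fun z hz => hz.2)
  have hlb : ∀ᶠ z in l, z ∈ A ∧ z ≠ β ∧ z ∈ ball β R := by
    filter_upwards [self_mem_nhdsWithin, mem_nhdsWithin_of_mem_nhds (ball_mem_nhds β hR)] with z h1 h2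
    exact ⟨h1.1, h1.2, h2⟩
  have hRr : R ≤ r / 8 := by linarith
  have hlim : ∀ k, Tendsto (fun z => (h k z - y (n k)) / (z - β)) l
      (𝓝 (lam ^ k / deriv (F.word (p (n k))) (y (n k)))) := by
    intro k
    have hyΩ := hAf.2.2.1 (hyA (n k))
    refine ratio_tendsto hlne (F.word_diffAt (p (n k)) hyΩ).hasDerivAt (g := G.word (W k)) ?_
      (hDfne _) ?_ (by rw [hpy, hW2]) ?_
    · have := (G.word_diffAt (W k) hβΩ).hasDerivAt
      rwa [hW3] at this
    · refine tendsto_nhdsWithin_iff.2 ⟨?_, ?_⟩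
      · have h0 : Tendsto (fun z => 2 * ‖z - β‖) l (𝓝 0) := by
          have : Tendsto (fun z : ℂ => 2 * ‖z - β‖) (𝓝 β) (𝓝 (2 * ‖β - β‖)) :=
            (by fun_prop : Continuous fun z : ℂ => 2 * ‖z - β‖).tendsto β
          rw [sub_self, norm_zero, mul_zero] at this
          exact this.mono_left nhdsWithin_le_nhds
        rw [tendsto_iff_norm_sub_tendsto_zero]
        refine squeeze_zero' (Eventually.of_forall fun _ => norm_nonneg _) ?_ h0
        filter_upwards [hlb] with z hz
        have := hhl k z hz.1 (ball_subset_ball hRr hz.2.2) β hβA (mem_ball_self (by linarith))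
        rw [hhβ] at this
        set μ := lam ^ k / deriv (F.word (p (n k))) (y (n k))
        have hμ1 := (hμ k).2
        calc _ = ‖(h k z - y (n k) - μ * (z - β)) + μ * (z - β)‖ := by congr 1; ring
          _ ≤ _ := norm_add_le _ _
          _ ≤ 4 * η * ‖z - β‖ + 1 * ‖z - β‖ := by rw [norm_mul]; gcongr
          _ ≤ _ := by nlinarith [norm_nonneg (z - β)]
      · filter_upwards [hlb] with z hz heq
        have heq : h k z = y (n k) := heq
        have h1 := (hhA k z hz.1 (ball_subset_ball hRr hz.2.2)).2
        rw [heq, hpy] at h1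
        exact hz.2.1 (G.word_inj (W k) (hAg.2.2.1 hz.1) hβΩ (by rw [← h1, hW2]))
    · filter_upwards [hlb] with z hz
      exact (hhA k z hz.1 (ball_subset_ball hRr hz.2.2)).2
  have hμeq : lam ^ k / deriv (F.word (p (n k))) (y (n k)) =
      lam ^ k' / deriv (F.word (p (n k'))) (y (n k')) := by
    refine tendsto_nhds_unique (hlim k) ((hlim k').congr' ?_)
    filter_upwards [hlb] with z hz
    rw [← hyy, hrig z hz.1 hz.2.2]
  obtain ⟨d, hd, rfl⟩ : ∃ d, 1 ≤ d ∧ k' = k + d := ⟨k' - k, by omega, by omega⟩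
  have hlk : lam ^ k ≠ 0 := pow_ne_zero _ hlam0
  have hdlt : ‖lam ^ d‖ < 1 := by
    rw [norm_pow]; exact pow_lt_one₀ (norm_nonneg _) hlam1 (by omega)
  have hyΩ := hAf.2.2.1 (hyA (n k))
  rw [div_eq_div_iff (hDfne _) (hDfne _), pow_add, mul_assoc] at hμeq
  have hμeq := mul_left_cancel₀ hlk hμeq
  have hD := hDfne (n k)
  have hD' := hDfne (n (k + d))
  rw [← hyy] at hμeq hD'
  rcases lt_trichotomy (n k) (n (k + d)) with hlt | heq | hgt
  · obtain ⟨u, hu1, hu2, hu3⟩ := hseg (n k) (n (k + d) - n k)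
    rw [show n k + (n (k + d) - n k) = n (k + d) by omega] at hu2 hu3
    rw [← hyy] at hu3
    rw [hu2, F.deriv_word_append _ _ hyΩ, hu3, mul_comm] at hμeq
    refine ⟨d, hd, by omega, u, y (n k), ?_, hyΩ, hu3, mul_right_cancel₀ hD ?_⟩
    · rintro rfl; simp at hu1; omega
    · rw [← hμeq]
  · exfalso
    rw [← heq] at hμeq
    have : lam ^ d = 1 := mul_right_cancel₀ hD (by rw [← hμeq, one_mul])
    rw [this] at hdlt; simp at hdlt
  · exfalso
    obtain ⟨u, hu1, hu2, hu3⟩ := hseg (n (k + d)) (n k - n (k + d))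
    rw [show n (k + d) + (n k - n (k + d)) = n k by omega] at hu2 hu3
    rw [← hyy] at hu3
    rw [hu2, F.deriv_word_append _ _ hyΩ, hu3] at hμeq
    have hune : u ≠ [] := by rintro rfl; simp at hu1; omega
    have h1 := (hAf.fixed hune hyΩ hu3).2
    have h2 : lam ^ d * deriv (F.word u) (y (n k)) = 1 := by
      apply mul_right_cancel₀ hD'
      rw [one_mul]; nth_rw 2 [hμeq]; ring
    have h3 := congrArg norm h2
    rw [norm_mul, norm_one] at h3
    nlinarith [norm_nonneg (lam ^ d), norm_nonneg (deriv (F.word u) (y (n k)))]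

end HolIFS

/-- Corollary: if `G`, `F` are two holomorphic IFS with the SSC sharing the same attractor,
then for every `λ ∈ σ(G)` there is `l` with `λ^l ∈ σ(F)` and vice versa, with all
exponents `l` bounded by a number depending only on `F` and `G`. -/
theorem stmt_18 (G F : HolIFS) (A : Set ℂ)
    (hAg : G.IsAttractor A) (hAf : F.IsAttractor A) (hA2 : A.Nontrivial)
    (hSSCg : G.SSC A) (hSSCf : F.SSC A) :
    ∃ L : ℕ, 1 ≤ L ∧
      (∀ lam ∈ G.spectrum, ∃ l : ℕ, 1 ≤ l ∧ l ≤ L ∧ lam ^ l ∈ F.spectrum) ∧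
      (∀ lam ∈ F.spectrum, ∃ l : ℕ, 1 ≤ l ∧ l ≤ L ∧ lam ^ l ∈ G.spectrum) := by
  obtain ⟨N, hN⟩ := HolIFS.oneway G F A hAg hAf hA2 hSSCg hSSCf
  obtain ⟨M, hM⟩ := HolIFS.oneway F G A hAf hAg hA2 hSSCf hSSCg
  refine ⟨N + M + 1, by omega, fun lam h => ?_, fun lam h => ?_⟩
  · obtain ⟨l, h1, h2, h3⟩ := hN lam h
    exact ⟨l, h1, by omega, h3⟩
  · obtain ⟨l, h1, h2, h3⟩ := hM lam h
    exact ⟨l, h1, by omega, h3⟩
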